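/- arXiv:2110.11804 — 5 statements merged into one kernel-verified Lean document; each statement's English description precedes it below -/
import Mathlib

section
/- (Lemma 1, implicit regularization of pruning probabilities.) In the linear model with stochastic pruning, let R̄(λ) = (1/(2M)) Σ_j (ψ(x_j)ᵀW̄ − y_j)² be the empirical risk of the mean predictor with weights W̄_i = λ_i w_i. Then for every i, the difference between the λ_i-derivative of the empirical Gibbs risk and the λ_i-derivative of the mean-predictor risk is ∂R̂(λ,w)/∂λ_i − ∂R̄(λ)/∂λ_i = (1/2 − λ_i) w_i² Σ_{ii}; in particular this difference is label-independent and depends only on w_i², λ_i and the feature variance Σ_{ii}. -/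
open Finset

/-- Probability of a given mask `b` under the product Bernoulli distribution with
keep-probabilities `lam`. -/
noncomputable def maskProb {D : ℕ} (lam : Fin D → ℝ) (b : Fin D → Bool) : ℝ :=
  ∏ i, if b i then lam i else 1 - lam i

/-- Empirical Gibbs risk under squared loss of the stochastic predictor obtained by
independently keeping weight `w i` with probability `lam i`:
`R̂(λ, w) = (1/(2M)) E[ Σ_j (ψ(x_j)ᵀ W - y_j)² ]`, the expectation over the mask
written as a finite sum over all masks. -/
noncomputable def gibbsRisk {d D M : ℕ} (ψ : (Fin d → ℝ) → Fin D → ℝ)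
    (x : Fin M → Fin d → ℝ) (y : Fin M → ℝ) (lam w : Fin D → ℝ) : ℝ :=
  ∑ b : Fin D → Bool, maskProb lam b *
    ((1 / (2 * (M : ℝ))) * ∑ j, (∑ i, ψ (x j) i * (if b i then w i else 0) - y j) ^ 2)

/-- Empirical feature covariance `Σ i k = (1/M) Σ_j ψ(x_j)_i ψ(x_j)_k`. -/
noncomputable def empCov {d D M : ℕ} (ψ : (Fin d → ℝ) → Fin D → ℝ)
    (x : Fin M → Fin d → ℝ) (i k : Fin D) : ℝ :=
  (1 / (M : ℝ)) * ∑ j, ψ (x j) i * ψ (x j) k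

/-- Feature alignment vector `A i = (1/M) Σ_j ψ(x_j)_i y_j`. -/
noncomputable def featAlign {d D M : ℕ} (ψ : (Fin d → ℝ) → Fin D → ℝ)
    (x : Fin M → Fin d → ℝ) (y : Fin M → ℝ) (i : Fin D) : ℝ :=
  (1 / (M : ℝ)) * ∑ j, ψ (x j) i * y j

/-- Empirical risk of the mean predictor `W̄` with entries `W̄_i = λ_i w_i`:
`R̄(λ) = (1/(2M)) Σ_j (ψ(x_j)ᵀ W̄ - y_j)²`. -/
noncomputable def meanRisk {d D M : ℕ} (ψ : (Fin d → ℝ) → Fin D → ℝ)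
    (x : Fin M → Fin d → ℝ) (y : Fin M → ℝ) (lam w : Fin D → ℝ) : ℝ :=
  (1 / (2 * (M : ℝ))) * ∑ j, (∑ i, ψ (x j) i * (lam i * w i) - y j) ^ 2

/-- Bias-variance decomposition of the squared error of a Bernoulli-masked sum. -/
theorem sum_maskProb_mul_sq {D : ℕ} (lam a : Fin D → ℝ) (c : ℝ) :
    ∑ b : Fin D → Bool, maskProb lam b * (∑ i, (if b i then a i else 0) - c) ^ 2
      = (∑ i, lam i * a i - c) ^ 2 + ∑ i, lam i * (1 - lam i) * a i ^ 2 := by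
  induction D generalizing c with
  | zero => simp [maskProb]
  | succ n ih =>
    rw [← (Fin.consEquiv fun _ => Bool).sum_comp, Fintype.sum_prod_type]
    have hkeep := ih (fun i => lam i.succ) (fun i => a i.succ) (c - a 0)
    have hdrop := ih (fun i => lam i.succ) (fun i => a i.succ) c
    simp only [maskProb] at hkeep hdrop
    simp only [maskProb, Fin.consEquiv_apply, Fintype.sum_bool, Fin.prod_univ_succ,
      Fin.sum_univ_succ, Fin.cons_zero, Fin.cons_succ, if_true, Bool.false_eq_true, if_false,
      mul_assoc, ← mul_sum, zero_add]
    simp only [add_comm (a 0), add_sub_assoc]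
    simp only [← neg_sub c (a 0), ← sub_eq_add_neg, hkeep, hdrop, mul_assoc]
    ring

/-- The Gibbs risk is the mean-predictor risk plus a label-independent variance penalty. -/
theorem gibbsRisk_eq_meanRisk_add {d D M : ℕ} (ψ : (Fin d → ℝ) → Fin D → ℝ)
    (x : Fin M → Fin d → ℝ) (y : Fin M → ℝ) (lam w : Fin D → ℝ) :
    gibbsRisk ψ x y lam w = meanRisk ψ x y lam w
      + ∑ k, lam k * (1 - lam k) * (1 / 2 * w k ^ 2 * empCov ψ x k k) := by
  have hpoint (j : Fin M) := sum_maskProb_mul_sq lam (fun k => ψ (x j) k * w k) (y j)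
  have hpenalty : ∑ k, lam k * (1 - lam k) * (1 / 2 * w k ^ 2 * empCov ψ x k k)
      = 1 / (2 * (M : ℝ)) * ∑ j, ∑ k, lam k * (1 - lam k) * (ψ (x j) k * w k) ^ 2 := by
    rw [sum_comm, mul_sum]
    refine sum_congr rfl fun k _ => ?_
    simp only [empCov, mul_sum]
    refine sum_congr rfl fun j _ => ?_
    rw [one_div_mul_eq_div, one_div_mul_eq_div, div_mul_eq_div_div]
    ring
  rw [hpenalty, meanRisk, ← mul_add, ← sum_add_distrib]
  simp only [gibbsRisk, mul_left_comm (maskProb lam _), mul_ite, mul_zero, mul_left_comm (ψ _ _),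
    ← hpoint]
  rw [← mul_sum, sum_comm]
  simp only [mul_sum]

theorem differentiable_meanRisk_update {d D M : ℕ} (ψ : (Fin d → ℝ) → Fin D → ℝ)
    (x : Fin M → Fin d → ℝ) (y : Fin M → ℝ) (lam w : Fin D → ℝ) (i : Fin D) :
    Differentiable ℝ fun t => meanRisk ψ x y (Function.update lam i t) w := by
  have hupdate (k : Fin D) : Differentiable ℝ fun t => Function.update lam i t k := fun t =>
    (hasDerivAt_pi.1 (hasDerivAt_update lam i t) k).differentiableAt
  unfold meanRisk
  fun_prop

theorem hasDerivAt_variance_penalty_update {D : ℕ} (lam c : Fin D → ℝ) (i : Fin D) (t : ℝ) :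
    HasDerivAt (fun t => ∑ k, Function.update lam i t k * (1 - Function.update lam i t k) * c k)
      ((1 - 2 * t) * c i) t := by
  have hsplit (s : ℝ) :
      ∑ k, Function.update lam i s k * (1 - Function.update lam i s k) * c k
        = s * (1 - s) * c i + ∑ k ∈ univ.erase i, lam k * (1 - lam k) * c k := by
    rw [← add_sum_erase _ _ (mem_univ i), Function.update_self]
    congr 1
    refine sum_congr rfl fun k hk => ?_
    rw [Function.update_of_ne (ne_of_mem_erase hk)]
  simp only [hsplit]
  refine HasDerivAt.congr_deriv (((hasDerivAt_id' t).fun_mul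
    ((hasDerivAt_id' t).const_sub 1)).mul_const (c i) |>.add_const _) ?_
  ring

/-- Lemma 1, implicit regularization of pruning probabilities:
the difference between the `λ_i`-derivative of the empirical Gibbs risk and the
`λ_i`-derivative of the mean-predictor risk equals `(1/2 - λ_i) w_i² Σ_{ii}`,
a label-independent quantity depending only on `w_i²`, `λ_i` and `Σ_{ii}`. -/
theorem implicit_regularization_of_pruning_probabilities
    (d D M : ℕ) (hM : 0 < M) (ψ : (Fin d → ℝ) → Fin D → ℝ)
    (x : Fin M → Fin d → ℝ) (y : Fin M → ℝ)
    (w lam : Fin D → ℝ) (hlam : ∀ i, lam i ∈ Set.Icc (0:ℝ) 1) (i : Fin D) :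
    deriv (fun t => gibbsRisk ψ x y (Function.update lam i t) w) (lam i)
      - deriv (fun t => meanRisk ψ x y (Function.update lam i t) w) (lam i)
      = (1 / 2 - lam i) * w i ^ 2 * empCov ψ x i i := by
  simp only [gibbsRisk_eq_meanRisk_add]
  have hpenalty := hasDerivAt_variance_penalty_update lam
    (fun k => 1 / 2 * w k ^ 2 * empCov ψ x k k) i (lam i)
  rw [deriv_fun_add (differentiable_meanRisk_update ψ x y lam w i _) hpenalty.differentiableAt,
    hpenalty.deriv]
  ring
end

section
/- In the linear model with stochastic pruning, suppose the empirical feature covariance Σ is diagonal with Σ_{ii} > 0 for all i, and suppose the weights are the least-squares optimum w_i = A_i / Σ_{ii}. Then for every i, the derivative of the empirical Gibbs risk with respect to λ_i equals ∂R̂(λ,w)/∂λ_i = −(1/2) w_i² Σ_{ii}, independently of λ. Consequently, under gradient descent on λ from a uniform initialization, the pruning probability λ_i increases at a rate proportional to the variance-weighted squared weight magnitude w_i² Σ_{ii} = A_i²/Σ_{ii}. -/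
open Finset

/-- The partial derivative of a linear functional in coordinate `i` is its `i`-th coefficient. -/
theorem hasDerivAt_sum_update_mul {D : ℕ} (g lam : Fin D → ℝ) (i : Fin D) (s : ℝ) :
    HasDerivAt (fun t => ∑ k, Function.update lam i t k * g k) (g i) s := by
  have hterm : ∀ k ∈ Finset.univ, HasDerivAt
      (fun t => Function.update lam i t k * g k) (if k = i then g k else 0) s := by
    intro k _
    by_cases hk : k = i
    · subst hk
      simpa using (hasDerivAt_id s).mul_const (g k)
    · simpa [hk] using hasDerivAt_const s (lam k * g k)
  simpa using HasDerivAt.fun_sum hterm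

/-- The masks have total probability one. -/
theorem sum_maskProb {D : ℕ} (lam : Fin D → ℝ) : ∑ b, maskProb lam b = 1 := by
  have h := Finset.prod_univ_sum (fun _ : Fin D => (Finset.univ : Finset Bool))
    (fun i c => if c then lam i else 1 - lam i)
  rw [Fintype.piFinset_univ] at h
  simp only [maskProb]
  rw [← h]
  simp

/-- The probability that weight `k` is kept is `lam k`. -/
theorem sum_maskProb_mul_indicator {D : ℕ} (lam : Fin D → ℝ) (k : Fin D) :
    ∑ b, maskProb lam b * (if b k then 1 else 0) = lam k := by
  have h := Finset.prod_univ_sum (fun _ : Fin D => (Finset.univ : Finset Bool))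
    (fun i c => (if c then lam i else 1 - lam i) * (if i = k then if c then 1 else 0 else 1))
  rw [Fintype.piFinset_univ] at h
  have hb : ∀ b : Fin D → Bool, maskProb lam b * (if b k then 1 else 0) =
      ∏ i, (if b i then lam i else 1 - lam i) *
        (if i = k then if b i then 1 else 0 else 1) := by
    intro b
    rw [Finset.prod_mul_distrib, Finset.prod_ite_eq' Finset.univ k]
    simp [maskProb]
  rw [Finset.sum_congr rfl fun b _ => hb b, ← h,
    Finset.prod_eq_single k (fun i _ hik => by simp [hik]) (by simp)]
  simp

/-- The empirical squared-error risk as a quadratic form in the weights. -/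
theorem empirical_risk_eq_quadratic {d D M : ℕ} (ψ : (Fin d → ℝ) → Fin D → ℝ)
    (x : Fin M → Fin d → ℝ) (y : Fin M → ℝ) (v : Fin D → ℝ) :
    (1 / (2 * (M : ℝ))) * ∑ j, (∑ i, ψ (x j) i * v i - y j) ^ 2 =
      (1 / (2 * (M : ℝ))) * ∑ j, y j ^ 2 + (1 / 2) * ∑ i, ∑ k, v i * v k * empCov ψ x i k
        - ∑ i, v i * featAlign ψ x y i := by
  have hcov : ∑ i, ∑ k, v i * v k * empCov ψ x i k =
      (1 / (M : ℝ)) * ∑ j, (∑ i, ψ (x j) i * v i) ^ 2 := by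
    simp only [empCov, sq, Finset.sum_mul_sum]
    simp only [Finset.mul_sum]
    rw [Finset.sum_comm (s := (Finset.univ : Finset (Fin M)))]
    refine Finset.sum_congr rfl fun i _ => ?_
    rw [Finset.sum_comm (s := (Finset.univ : Finset (Fin M)))]
    refine Finset.sum_congr rfl fun k _ => Finset.sum_congr rfl fun j _ => ?_
    ring
  have halign : ∑ i, v i * featAlign ψ x y i =
      (1 / (M : ℝ)) * ∑ j, (∑ i, ψ (x j) i * v i) * y j := by
    simp only [featAlign, Finset.mul_sum, Finset.sum_mul]
    rw [Finset.sum_comm]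
    refine Finset.sum_congr rfl fun j _ => Finset.sum_congr rfl fun i _ => ?_
    ring
  have hsq : ∑ j, (∑ i, ψ (x j) i * v i - y j) ^ 2 =
      ∑ j, (∑ i, ψ (x j) i * v i) ^ 2 - 2 * ∑ j, (∑ i, ψ (x j) i * v i) * y j
        + ∑ j, y j ^ 2 := by
    rw [Finset.mul_sum, ← Finset.sum_sub_distrib, ← Finset.sum_add_distrib]
    exact Finset.sum_congr rfl fun j _ => by ring
  rw [hcov, halign, hsq]
  ring

/-- With diagonal covariance and least-squares weights, the Gibbs risk is affine in the
keep-probabilities. -/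
theorem gibbsRisk_eq_affine {d D M : ℕ} (ψ : (Fin d → ℝ) → Fin D → ℝ)
    (x : Fin M → Fin d → ℝ) (y : Fin M → ℝ) (w : Fin D → ℝ)
    (hdiag : ∀ i k, i ≠ k → empCov ψ x i k = 0)
    (hw : ∀ i, featAlign ψ x y i = w i * empCov ψ x i i) (lam : Fin D → ℝ) :
    gibbsRisk ψ x y lam w = (1 / (2 * (M : ℝ))) * ∑ j, y j ^ 2 +
      ∑ k, lam k * (-(1 / 2) * w k ^ 2 * empCov ψ x k k) := by
  have hmask : ∀ b : Fin D → Bool,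
      (1 / (2 * (M : ℝ))) * ∑ j, (∑ i, ψ (x j) i * (if b i then w i else 0) - y j) ^ 2 =
        (1 / (2 * (M : ℝ))) * ∑ j, y j ^ 2 +
          ∑ k, (if b k then 1 else 0) * (-(1 / 2) * w k ^ 2 * empCov ψ x k k) := by
    intro b
    rw [empirical_risk_eq_quadratic ψ x y fun i => if b i then w i else 0, add_sub_assoc]
    congr 1
    rw [Finset.mul_sum, ← Finset.sum_sub_distrib]
    refine Finset.sum_congr rfl fun i _ => ?_
    rw [Finset.sum_eq_single i (fun k _ hki => by rw [hdiag i k hki.symm, mul_zero]) (by simp),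
      hw]
    split_ifs <;> ring
  simp only [gibbsRisk, hmask, mul_add, Finset.sum_add_distrib]
  rw [← Finset.sum_mul, sum_maskProb, one_mul]
  congr 1
  simp only [Finset.mul_sum, ← mul_assoc]
  rw [Finset.sum_comm]
  refine Finset.sum_congr rfl fun k _ => ?_
  simp only [← Finset.sum_mul, sum_maskProb_mul_indicator]

/-- when the empirical feature covariance is diagonal with positive
diagonal and the weights are the least-squares optimum `w_i = A_i / Σ_{ii}`, the
derivative of the empirical Gibbs risk with respect to `λ_i` equals
`-(1/2) w_i² Σ_{ii}`, independently of `λ`; moreover the variance-weighted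
squared magnitude satisfies `w_i² Σ_{ii} = A_i² / Σ_{ii}`. -/
theorem gibbs_lambda_deriv_diagonal_least_squares
    (d D M : ℕ) (hM : 0 < M) (ψ : (Fin d → ℝ) → Fin D → ℝ)
    (x : Fin M → Fin d → ℝ) (y : Fin M → ℝ) (w : Fin D → ℝ)
    (hdiag : ∀ i k, i ≠ k → empCov ψ x i k = 0)
    (hpos : ∀ i, 0 < empCov ψ x i i)
    (hw : ∀ i, w i = featAlign ψ x y i / empCov ψ x i i) :
    (∀ lam : Fin D → ℝ, ∀ i : Fin D,
        HasDerivAt (fun t => gibbsRisk ψ x y (Function.update lam i t) w)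
          (-(1 / 2) * w i ^ 2 * empCov ψ x i i) (lam i))
    ∧ (∀ i, w i ^ 2 * empCov ψ x i i
          = (featAlign ψ x y i) ^ 2 / empCov ψ x i i) := by
  have halign : ∀ i, featAlign ψ x y i = w i * empCov ψ x i i := fun i => by
    rw [hw i, div_mul_cancel₀ _ (hpos i).ne']
  refine ⟨fun lam i => ?_, fun i => ?_⟩
  · simp only [gibbsRisk_eq_affine ψ x y w hdiag halign]
    exact (hasDerivAt_sum_update_mul _ lam i (lam i)).const_add _
  · rw [halign i]
    have := (hpos i).ne'
    field_simp
end

section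
/- (PAC-Bayes theorem of Langford–Seeger.) Let Z be a measurable space, 𝒟 a probability measure on Z, H a measurable space of hypotheses, and ℓ: H × Z → [0,1] a measurable loss. For every fixed probability measure P on H ('prior'), every N ∈ ℕ, and every δ ∈ (0,1): with probability at least 1 − δ over the draw of an i.i.d. sample S = (z_1, …, z_N) ~ 𝒟^N, it holds simultaneously for all probability measures Q on H that R_𝒟(Q) ≤ klinv( R̂_S(Q), (KL(Q‖P) + log(2√N/δ)) / N ). -/
open MeasureTheory Finset
open scoped ENNReal Classical


/-- Kullback--Leibler divergence `KL(Q‖P)`: `∫ log (dQ/dP) dQ` when `Q ≪ P` (and the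
integrand is `Q`-integrable), and `+∞` otherwise. -/
noncomputable def klDiv {H : Type*} [MeasurableSpace H] (Q P : Measure H) : ℝ≥0∞ :=
  if Q ≪ P ∧ Integrable (fun h => Real.log ((Q.rnDeriv P h).toReal)) Q then
    ENNReal.ofReal (∫ h, Real.log ((Q.rnDeriv P h).toReal) ∂Q)
  else ⊤

/-- Binary Kullback--Leibler divergence `klbin(q‖p)`, extended by continuity to the
endpoints `p ∈ {0,1}` (taking the value `⊤` there unless `q = p`). -/
noncomputable def klBin (q p : ℝ) : ℝ≥0∞ :=
  if p ≤ 0 ∨ 1 ≤ p then (if q = p then 0 else ⊤)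
  else ENNReal.ofReal (q * Real.log (q / p) + (1 - q) * Real.log ((1 - q) / (1 - p)))

/-- Inverse binary KL divergence: `klinv(a, ε) = sup { p ∈ [0,1] : klbin(a‖p) ≤ ε }`. -/
noncomputable def klInv (a : ℝ) (ε : ℝ≥0∞) : ℝ :=
  sSup {p : ℝ | p ∈ Set.Icc (0:ℝ) 1 ∧ klBin a p ≤ ε}

theorem sum_inv_sqrt_le (n : ℕ) :
    ∑ k ∈ range (n + 1), 1 / √((k : ℝ) + 1) ≤ 2 * √((n : ℝ) + 1) - 1 := by
  induction n with
  | zero => norm_num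
  | succ n ih =>
    rw [sum_range_succ]
    push_cast
    have hs : 0 < √((n : ℝ) + 1) := by positivity
    have ht : 0 < √((n : ℝ) + 1 + 1) := by positivity
    have hs2 : √((n : ℝ) + 1) ^ 2 = n + 1 := Real.sq_sqrt (by positivity)
    have ht2 : √((n : ℝ) + 1 + 1) ^ 2 = n + 1 + 1 := Real.sq_sqrt (by positivity)
    have key : 1 / √((n : ℝ) + 1 + 1) ≤ 2 * √((n : ℝ) + 1 + 1) - 2 * √((n : ℝ) + 1) := by
      rw [div_le_iff₀ ht]
      nlinarith [sq_nonneg (√((n : ℝ) + 1 + 1) - √((n : ℝ) + 1))]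
    linarith

theorem factorial_eq_stirlingSeq_mul (n : ℕ) (hn : n ≠ 0) :
    (n.factorial : ℝ) = Stirling.stirlingSeq n * (√(2 * n) * (n / Real.exp 1) ^ n) := by
  have : (n : ℝ) ≠ 0 := by exact_mod_cast hn
  rw [Stirling.stirlingSeq, div_mul_cancel₀]
  positivity

theorem stirlingSeq_le_one (n : ℕ) (hn : n ≠ 0) :
    Stirling.stirlingSeq n ≤ Real.exp 1 / √2 := by
  obtain ⟨m, rfl⟩ := Nat.exists_eq_succ_of_ne_zero hn
  rw [← Stirling.stirlingSeq_one]
  exact Stirling.stirlingSeq'_antitone (Nat.zero_le m)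

/-- Each interior binomial likelihood at its own maximum is of order `1/√k + 1/√(N-k)`. -/
theorem add_choose_mul_pow_le (k m : ℕ) (hk : k ≠ 0) (hm : m ≠ 0) :
    ((k + m).choose k : ℝ) * ((k : ℝ) / (k + m)) ^ k * ((m : ℝ) / (k + m)) ^ m
      ≤ Real.exp 1 / (2 * Real.pi) * (1 / √k + 1 / √m) := by
  have hk0 : (0 : ℝ) < k := by positivity
  have hm0 : (0 : ℝ) < m := by positivity
  have hsk : √Real.pi ≤ Stirling.stirlingSeq k := Stirling.sqrt_pi_le_stirlingSeq hk
  have hsm : √Real.pi ≤ Stirling.stirlingSeq m := Stirling.sqrt_pi_le_stirlingSeq hm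
  have hsN := stirlingSeq_le_one (k + m) (by omega)
  have hpi : 0 < √Real.pi := by positivity
  have hck := hpi.trans_le hsk
  have hcm := hpi.trans_le hsm
  have hpp : Real.pi ≤ Stirling.stirlingSeq k * Stirling.stirlingSeq m := by
    calc Real.pi = √Real.pi * √Real.pi := (Real.mul_self_sqrt Real.pi_pos.le).symm
      _ ≤ _ := by gcongr
  have hcpos : 0 < Stirling.stirlingSeq k * Stirling.stirlingSeq m := by positivity
  have heq : ((k + m).choose k : ℝ) * ((k : ℝ) / (k + m)) ^ k * ((m : ℝ) / (k + m)) ^ m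
      = Stirling.stirlingSeq (k + m) / (Stirling.stirlingSeq k * Stirling.stirlingSeq m)
        * (√(k + m) / (√2 * (√k * √m))) := by
    have h := Nat.add_choose_mul_factorial_mul_factorial k m
    have h' : ((k + m).choose k : ℝ) * k.factorial * m.factorial = (k + m).factorial := by
      rw [Nat.choose_symm_add]
      exact_mod_cast h
    rw [factorial_eq_stirlingSeq_mul k hk, factorial_eq_stirlingSeq_mul m hm,
      factorial_eq_stirlingSeq_mul (k + m) (by omega)] at h'
    push_cast at h'
    rw [Real.sqrt_mul (by norm_num), Real.sqrt_mul (by norm_num), Real.sqrt_mul (by norm_num)] at h'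
    simp only [div_pow] at h' ⊢
    rw [pow_add, pow_add] at h'
    have h1 : Stirling.stirlingSeq k ≠ 0 := by positivity
    have h2 : Stirling.stirlingSeq m ≠ 0 := by positivity
    have h3 : √(k : ℝ) ≠ 0 := by positivity
    have h4 : √(m : ℝ) ≠ 0 := by positivity
    have h5 : Real.exp 1 ≠ 0 := by positivity
    have h6 : √(2 : ℝ) ≠ 0 := by positivity
    field_simp at h' ⊢
    linear_combination h'
  have hsq : √((k : ℝ) + m) ≤ √k + √m := by
    rw [Real.sqrt_le_left (by positivity)]
    nlinarith [Real.sq_sqrt hk0.le, Real.sq_sqrt hm0.le,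
      mul_nonneg (Real.sqrt_nonneg k) (Real.sqrt_nonneg m)]
  rw [heq]
  calc _ ≤ (Real.exp 1 / √2) / Real.pi * ((√k + √m) / (√2 * (√k * √m))) := by gcongr
    _ = _ := by
      have h3 : √(k : ℝ) ≠ 0 := by positivity
      have h4 : √(m : ℝ) ≠ 0 := by positivity
      have h6 : √(2 : ℝ) ^ 2 = 2 := Real.sq_sqrt (by norm_num)
      field_simp
      rw [h6]
      ring

theorem sum_choose_mul_pow_le_of_lt (N : ℕ) (hN : 0 < N) (hN' : N < 18) :
    ∑ k ∈ range (N + 1), (N.choose k : ℝ) * ((k : ℝ) / N) ^ k * (1 - (k : ℝ) / N) ^ (N - k)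
      ≤ 2 * √N := by
  have : ∀ {x y : ℝ}, 0 ≤ y → x ^ 2 ≤ 4 * y → x ≤ 2 * √y := by
    intro x y hy h
    refine abs_le_of_sq_le_sq' ?_ (by positivity) |>.2
    rw [mul_pow, Real.sq_sqrt hy]
    linarith
  apply this (by positivity)
  interval_cases N <;> norm_num [sum_range_succ, Nat.choose]

theorem sum_choose_mul_pow_le_of_ge (N : ℕ) (hN : 18 ≤ N) :
    ∑ k ∈ range (N + 1), (N.choose k : ℝ) * ((k : ℝ) / N) ^ k * (1 - (k : ℝ) / N) ^ (N - k)
      ≤ 2 * √N := by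
  obtain ⟨n, rfl⟩ : ∃ n, N = n + 2 := ⟨N - 2, by omega⟩
  have hpos : (0 : ℝ) < ((n + 2 : ℕ) : ℝ) := by positivity
  rw [sum_range_succ, sum_range_succ']
  have hterm : ∀ k ∈ range (n + 1),
      ((n + 2).choose (k + 1) : ℝ) * (((k + 1 : ℕ) : ℝ) / (n + 2 : ℕ)) ^ (k + 1)
        * (1 - ((k + 1 : ℕ) : ℝ) / (n + 2 : ℕ)) ^ (n + 2 - (k + 1))
      ≤ Real.exp 1 / (2 * Real.pi) * (1 / √((k : ℝ) + 1) + 1 / √(((n - k : ℕ) : ℝ) + 1)) := by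
    intro k hk
    have hk' : k ≤ n := by simpa [Nat.lt_succ_iff] using hk
    obtain ⟨m, rfl⟩ := Nat.exists_eq_add_of_le hk'
    have h := add_choose_mul_pow_le (k + 1) (m + 1) (by omega) (by omega)
    rw [show k + m + 2 - (k + 1) = m + 1 by omega, show k + m - k = m by omega,
      show k + m + 2 = (k + 1) + (m + 1) by omega]
    push_cast at h ⊢
    convert h using 3
    field_simp
    ring
  have hsum := sum_le_sum hterm
  rw [← mul_sum, sum_add_distrib] at hsum
  have hrefl : ∑ k ∈ range (n + 1), 1 / √(((n - k : ℕ) : ℝ) + 1)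
      = ∑ k ∈ range (n + 1), 1 / √((k : ℝ) + 1) := by
    rw [← sum_range_reflect (fun k : ℕ => 1 / √((k : ℝ) + 1))]
    simp
  rw [hrefl] at hsum
  have hS := sum_inv_sqrt_le n
  have hc : Real.exp 1 / (2 * Real.pi) ≤ 0.4327 := by
    rw [div_le_iff₀ (by positivity)]
    nlinarith [Real.exp_one_lt_d9, Real.pi_gt_d4]
  have hc0 : 0 ≤ Real.exp 1 / (2 * Real.pi) := by positivity
  have hmono : √((n : ℝ) + 1) ≤ √((n + 2 : ℕ) : ℝ) := by
    apply Real.sqrt_le_sqrt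
    push_cast
    linarith
  have hbig : 4.24 ≤ √((n + 2 : ℕ) : ℝ) := by
    apply Real.le_sqrt_of_sq_le
    have : (18 : ℝ) ≤ ((n + 2 : ℕ) : ℝ) := by exact_mod_cast hN
    linarith
  have hprod : Real.exp 1 / (2 * Real.pi) * (∑ k ∈ range (n + 1), 1 / √((k : ℝ) + 1)
      + ∑ k ∈ range (n + 1), 1 / √((k : ℝ) + 1)) ≤ 0.4327 * (4 * √((n + 2 : ℕ) : ℝ) - 2) := by
    have : (0 : ℝ) ≤ ∑ k ∈ range (n + 1), 1 / √((k : ℝ) + 1) :=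
      sum_nonneg fun _ _ => by positivity
    apply mul_le_mul hc (by linarith) (by linarith) (by norm_num)
  have e1 : ((n + 2).choose (n + 2) : ℝ) * (((n + 2 : ℕ) : ℝ) / (n + 2 : ℕ)) ^ (n + 2)
      * (1 - ((n + 2 : ℕ) : ℝ) / (n + 2 : ℕ)) ^ (n + 2 - (n + 2)) = 1 := by
    rw [div_self hpos.ne']; simp
  have e0 : ((n + 2).choose 0 : ℝ) * (((0 : ℕ) : ℝ) / (n + 2 : ℕ)) ^ 0
      * (1 - ((0 : ℕ) : ℝ) / (n + 2 : ℕ)) ^ (n + 2 - 0) = 1 := by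
    simp
  rw [e0, e1]
  linarith

/-- Maurer's bound on the sum of the maximal binomial likelihoods. -/
theorem sum_choose_mul_pow_le (N : ℕ) (hN : 0 < N) :
    ∑ k ∈ range (N + 1), (N.choose k : ℝ) * ((k : ℝ) / N) ^ k * (1 - (k : ℝ) / N) ^ (N - k)
      ≤ 2 * √N := by
  rcases lt_or_ge N 18 with h | h
  · exact sum_choose_mul_pow_le_of_lt N hN h
  · exact sum_choose_mul_pow_le_of_ge N h

/-- The finite expression for the binary Kullback--Leibler divergence. -/
noncomputable def klBinReal (q p : ℝ) : ℝ :=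
  q * Real.log (q / p) + (1 - q) * Real.log ((1 - q) / (1 - p))

/-- The probability of the set `s` of successes among independent Bernoulli trials with
success probabilities `x i`. -/
noncomputable def bernoulliWeight {N : ℕ} (x : Fin N → ℝ) (s : Finset (Fin N)) : ℝ :=
  ∏ i, if i ∈ s then x i else 1 - x i

theorem mul_log_div_eq (q p : ℝ) (hp : p ≠ 0) :
    q * Real.log (q / p) = q * Real.log q - q * Real.log p := by
  rcases eq_or_ne q 0 with rfl | hq
  · simp
  · rw [Real.log_div hq hp]; ring

theorem klBinReal_eq (q p : ℝ) (hp : p ∈ Set.Ioo (0 : ℝ) 1) :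
    klBinReal q p
      = -Real.binEntropy q - (q * Real.log p + (1 - q) * Real.log (1 - p)) := by
  have h1 : (1 - p) ≠ 0 := by linarith [hp.2]
  rw [klBinReal, mul_log_div_eq _ _ hp.1.ne', mul_log_div_eq _ _ h1, Real.binEntropy,
    Real.log_inv, Real.log_inv]
  ring

theorem convexOn_klBinReal (p : ℝ) (hp : p ∈ Set.Ioo (0 : ℝ) 1) :
    ConvexOn ℝ (Set.Icc 0 1) (fun q => klBinReal q p) := by
  have h : ConvexOn ℝ (Set.Icc (0 : ℝ) 1) (fun q => -Real.binEntropy q) :=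
    Real.strictConcave_binEntropy.concaveOn.neg
  refine ⟨convex_Icc 0 1, fun x hx y hy a b ha hb hab => ?_⟩
  have := h.2 hx hy ha hb hab
  simp only [smul_eq_mul, klBinReal_eq _ _ hp] at this ⊢
  obtain rfl : b = 1 - a := by linarith
  linarith

theorem convexOn_exp_mul_klBinReal (p : ℝ) (hp : p ∈ Set.Ioo (0 : ℝ) 1) (N : ℕ) :
    ConvexOn ℝ (Set.Icc 0 1) (fun q => Real.exp (N * klBinReal q p)) := by
  refine ⟨convex_Icc 0 1, fun x hx y hy a b ha hb hab => ?_⟩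
  refine le_trans (Real.exp_le_exp.2 ?_) (convexOn_exp.2 (Set.mem_univ _) (Set.mem_univ _) ha hb hab)
  have := mul_le_mul_of_nonneg_left ((convexOn_klBinReal p hp).2 hx hy ha hb hab)
    (Nat.cast_nonneg (α := ℝ) N)
  simp only [smul_eq_mul] at this ⊢
  linarith

theorem bernoulliWeight_nonneg {N : ℕ} (x : Fin N → ℝ) (hx : ∀ i, x i ∈ Set.Icc (0 : ℝ) 1)
    (s : Finset (Fin N)) : 0 ≤ bernoulliWeight x s := by
  refine prod_nonneg fun i _ => ?_
  split_ifs
  · exact (hx i).1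
  · linarith [(hx i).2]

theorem sum_prod_ite_mem {N : ℕ} (f g : Fin N → ℝ) :
    ∑ s : Finset (Fin N), ∏ i, (if i ∈ s then f i else g i) = ∏ i, (f i + g i) := by
  rw [Fintype.prod_add]
  refine sum_congr rfl fun s _ => ?_
  rw [prod_ite]
  congr 1 <;> refine prod_congr ?_ fun _ _ => rfl <;> ext <;> simp

theorem sum_bernoulliWeight {N : ℕ} (x : Fin N → ℝ) :
    ∑ s, bernoulliWeight x s = 1 := by
  simp only [bernoulliWeight]
  rw [sum_prod_ite_mem]
  simp

theorem sum_bernoulliWeight_mul_card {N : ℕ} (x : Fin N → ℝ) :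
    ∑ s, bernoulliWeight x s * (s.card : ℝ) = ∑ i, x i := by
  have hi : ∀ i, ∑ s, (if i ∈ s then bernoulliWeight x s else 0) = x i := by
    intro i
    have h := sum_prod_ite_mem x (fun j => if j = i then 0 else 1 - x j)
    have hr : ∏ j, (x j + if j = i then 0 else 1 - x j) = x i := by
      rw [prod_eq_single i] <;> simp +contextual
    rw [hr] at h
    rw [← h]
    refine sum_congr rfl fun s _ => ?_
    split_ifs with his
    · refine prod_congr rfl fun j _ => ?_
      by_cases hj : j = i
      · subst hj; simp [his]
      · simp [hj]
    · symm
      exact prod_eq_zero (mem_univ i) (by simp [his])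
  rw [← sum_congr rfl fun i _ => hi i, sum_comm]
  refine sum_congr rfl fun s _ => ?_
  rw [sum_ite_mem]
  simp [mul_comm]

/-- Convexity bounds the exponential of the divergence at an average by a Bernoulli mixture. -/
theorem exp_klBinReal_average_le {N : ℕ} (hN : 0 < N) (x : Fin N → ℝ)
    (hx : ∀ i, x i ∈ Set.Icc (0 : ℝ) 1) (p : ℝ) (hp : p ∈ Set.Ioo (0 : ℝ) 1) :
    Real.exp (N * klBinReal ((1 / (N : ℝ)) * ∑ i, x i) p)
      ≤ ∑ s : Finset (Fin N), bernoulliWeight x s *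
          Real.exp (N * klBinReal ((s.card : ℝ) / N) p) := by
  have h := (convexOn_exp_mul_klBinReal p hp N).map_sum_le (t := univ)
    (w := bernoulliWeight x) (p := fun s : Finset (Fin N) => (s.card : ℝ) / N)
    (fun s _ => bernoulliWeight_nonneg x hx s) (sum_bernoulliWeight x)
    (fun s _ => ⟨by positivity, by
      rw [div_le_one (by positivity)]
      exact_mod_cast (card_le_univ s).trans_eq (Fintype.card_fin N)⟩)
  simp only [smul_eq_mul] at h
  have hmean : (1 / (N : ℝ)) * ∑ i, x i
      = ∑ s : Finset (Fin N), bernoulliWeight x s * ((s.card : ℝ) / N) := by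
    rw [← sum_bernoulliWeight_mul_card, mul_sum]
    exact sum_congr rfl fun s _ => by ring
  rw [hmean]
  exact h

theorem pow_mul_exp_klBinReal {N k : ℕ} (hN : 0 < N) (hk : k ≤ N) (p : ℝ)
    (hp : p ∈ Set.Ioo (0 : ℝ) 1) :
    p ^ k * (1 - p) ^ (N - k) * Real.exp (N * klBinReal ((k : ℝ) / N) p)
      = ((k : ℝ) / N) ^ k * (1 - (k : ℝ) / N) ^ (N - k) := by
  have hN0 : (0 : ℝ) < N := by positivity
  have aux : ∀ (m : ℕ) (r : ℝ), 0 < r →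
      Real.exp (m * Real.log (((m : ℝ) / N) / r)) * r ^ m = ((m : ℝ) / N) ^ m := by
    intro m r hr
    rcases Nat.eq_zero_or_pos m with rfl | hm
    · simp
    · rw [Real.exp_nat_mul, Real.exp_log (by positivity), ← mul_pow]
      congr 1
      field_simp
  have h1 := aux k p hp.1
  have h2 := aux (N - k) (1 - p) (by linarith [hp.2])
  have hsub : (((N - k : ℕ) : ℝ) / N) = 1 - (k : ℝ) / N := by
    rw [Nat.cast_sub hk]; field_simp
  have hexp : (N : ℝ) * klBinReal ((k : ℝ) / N) p
      = k * Real.log (((k : ℝ) / N) / p)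
        + (N - k : ℕ) * Real.log ((((N - k : ℕ) : ℝ) / N) / (1 - p)) := by
    rw [klBinReal, hsub, Nat.cast_sub hk]
    field_simp
  rw [hexp, Real.exp_add, ← hsub, ← h1, ← h2]
  ring

/-- Maurer's exponential moment bound, in the nondegenerate case. -/
theorem lintegral_exp_klBinReal_le {Z : Type*} [MeasurableSpace Z] (μ : Measure Z)
    [IsProbabilityMeasure μ] (f : Z → ℝ) (hf : Measurable f)
    (hf01 : ∀ z, f z ∈ Set.Icc (0 : ℝ) 1) (N : ℕ) (hN : 0 < N)
    (hp : ∫ z, f z ∂μ ∈ Set.Ioo (0 : ℝ) 1) :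
    ∫⁻ S, ENNReal.ofReal (Real.exp (N * klBinReal ((1 / (N : ℝ)) * ∑ i, f (S i)) (∫ z, f z ∂μ)))
        ∂(Measure.pi fun _ : Fin N => μ) ≤ ENNReal.ofReal (2 * √N) := by
  set p := ∫ z, f z ∂μ with hpdef
  have hfi : Integrable f μ := .of_mem_Icc 0 1 hf.aemeasurable (ae_of_all _ hf01)
  have hgi : ∀ (s : Finset (Fin N)) (i : Fin N),
      Integrable (fun z => if i ∈ s then f z else 1 - f z) μ := by
    intro s i
    split_ifs
    · exact hfi
    · exact (integrable_const 1).sub hfi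
  have hwi : ∀ s : Finset (Fin N), Integrable (fun S : Fin N → Z =>
      bernoulliWeight (fun i => f (S i)) s) (Measure.pi fun _ => μ) :=
    fun s => Integrable.fintype_prod_dep (hgi s)
  have hw : ∀ s : Finset (Fin N), ∫ S : Fin N → Z, bernoulliWeight (fun i => f (S i)) s
      ∂(Measure.pi fun _ => μ) = p ^ s.card * (1 - p) ^ (N - s.card) := by
    intro s
    have := integral_fintype_prod_eq_prod (𝕜 := ℝ) (μ := fun _ : Fin N => μ)
      (fun i z => if i ∈ s then f z else 1 - f z)
    refine this.trans ?_
    have hi : ∀ i, ∫ z, (if i ∈ s then f z else 1 - f z) ∂μ = if i ∈ s then p else 1 - p := by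
      intro i
      split_ifs
      · rfl
      · rw [integral_sub (integrable_const 1) hfi]; simp [hpdef]
    simp_rw [hi]
    rw [prod_ite, prod_const, prod_const]
    have h1 : (univ.filter fun i => i ∈ s) = s := by ext; simp
    have h2 : (univ.filter fun i => i ∉ s) = sᶜ := by ext; simp
    rw [h1, h2, card_compl, Fintype.card_fin]
  have hint : Integrable (fun S : Fin N → Z => ∑ s : Finset (Fin N),
      bernoulliWeight (fun i => f (S i)) s * Real.exp (N * klBinReal ((s.card : ℝ) / N) p))
      (Measure.pi fun _ => μ) :=
    integrable_finsetSum _ fun s _ => (hwi s).mul_const _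
  calc _ ≤ ∫⁻ S : Fin N → Z, ENNReal.ofReal (∑ s : Finset (Fin N),
      bernoulliWeight (fun i => f (S i)) s * Real.exp (N * klBinReal ((s.card : ℝ) / N) p))
        ∂(Measure.pi fun _ => μ) := by
        refine lintegral_mono fun S => ENNReal.ofReal_le_ofReal ?_
        exact exp_klBinReal_average_le hN _ (fun i => hf01 _) p hp
    _ = ENNReal.ofReal (∫ S : Fin N → Z, ∑ s : Finset (Fin N),
      bernoulliWeight (fun i => f (S i)) s * Real.exp (N * klBinReal ((s.card : ℝ) / N) p)
        ∂(Measure.pi fun _ => μ)) := by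
        refine (ofReal_integral_eq_lintegral_ofReal hint (ae_of_all _ fun S => ?_)).symm
        exact sum_nonneg fun s _ => mul_nonneg
          (bernoulliWeight_nonneg _ (fun i => hf01 _) s) (Real.exp_pos _).le
    _ ≤ _ := by
        refine ENNReal.ofReal_le_ofReal ?_
        rw [integral_finsetSum _ fun s _ => (hwi s).mul_const _]
        simp_rw [integral_mul_const, hw]
        have hcard := sum_powerset_apply_card (x := (univ : Finset (Fin N)))
          (fun k => p ^ k * (1 - p) ^ (N - k) * Real.exp (N * klBinReal ((k : ℝ) / N) p))
        rw [powerset_univ, card_univ, Fintype.card_fin] at hcard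
        rw [hcard]
        refine le_trans (le_of_eq (sum_congr rfl fun k hk => ?_)) (sum_choose_mul_pow_le N hN)
        rw [pow_mul_exp_klBinReal hN (by simpa [Nat.lt_succ_iff] using hk) p hp, nsmul_eq_mul]
        ring

/-- The exponential of `N` times the binary Kullback--Leibler divergence, infinite where the
divergence is. -/
noncomputable def expKlBin (N : ℕ) (q p : ℝ) : ℝ≥0∞ :=
  if (p = 0 ∧ q ≠ 0) ∨ (p = 1 ∧ q ≠ 1) then ⊤ else ENNReal.ofReal (Real.exp (N * klBinReal q p))

theorem measurable_expKlBin {α : Type*} [MeasurableSpace α] (N : ℕ) {q p : α → ℝ}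
    (hq : Measurable q) (hp : Measurable p) :
    Measurable fun x => expKlBin N (q x) (p x) := by
  unfold expKlBin klBinReal
  refine Measurable.ite ?_ measurable_const (by fun_prop)
  have h0 := measurableSet_eq_fun hp (measurable_const (a := (0 : ℝ)))
  have h1 := measurableSet_eq_fun hp (measurable_const (a := (1 : ℝ)))
  have h2 := measurableSet_eq_fun hq (measurable_const (a := (0 : ℝ)))
  have h3 := measurableSet_eq_fun hq (measurable_const (a := (1 : ℝ)))
  exact (h0.inter h2.compl).union (h1.inter h3.compl)

theorem ae_pi_forall {Z : Type*} [MeasurableSpace Z] (μ : Measure Z) [IsProbabilityMeasure μ]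
    (N : ℕ) {r : Z → Prop} (h : ∀ᵐ z ∂μ, r z) :
    ∀ᵐ S ∂(Measure.pi fun _ : Fin N => μ), ∀ i, r (S i) :=
  Filter.eventually_all.2 fun i =>
    (measurePreserving_eval (fun _ : Fin N => μ) i).quasiMeasurePreserving.ae h

theorem lintegral_expKlBin_le {Z : Type*} [MeasurableSpace Z] (μ : Measure Z)
    [IsProbabilityMeasure μ] (f : Z → ℝ) (hf : Measurable f)
    (hf01 : ∀ z, f z ∈ Set.Icc (0 : ℝ) 1) (N : ℕ) (hN : 0 < N) :
    ∫⁻ S, expKlBin N ((1 / (N : ℝ)) * ∑ i, f (S i)) (∫ z, f z ∂μ)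
        ∂(Measure.pi fun _ : Fin N => μ) ≤ ENNReal.ofReal (2 * √N) := by
  have hfi : Integrable f μ := .of_mem_Icc 0 1 hf.aemeasurable (ae_of_all _ hf01)
  have hN0 : (N : ℝ) ≠ 0 := by positivity
  have hone : (1 : ℝ) ≤ 2 * √N := by
    have : (1 : ℝ) ≤ √N := Real.one_le_sqrt.2 (by exact_mod_cast hN)
    linarith
  have hconst : ∀ c : ℝ, c = 0 ∨ c = 1 → (∀ᵐ z ∂μ, f z = c) → ∫ z, f z ∂μ = c →
      ∫⁻ S, expKlBin N ((1 / (N : ℝ)) * ∑ i, f (S i)) (∫ z, f z ∂μ)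
        ∂(Measure.pi fun _ : Fin N => μ) ≤ ENNReal.ofReal (2 * √N) := by
    intro c hc hae hint
    have : ∀ᵐ S ∂(Measure.pi fun _ : Fin N => μ),
        expKlBin N ((1 / (N : ℝ)) * ∑ i, f (S i)) (∫ z, f z ∂μ) = 1 := by
      filter_upwards [ae_pi_forall μ N hae] with S hS
      have : (1 / (N : ℝ)) * ∑ i, f (S i) = c := by simp [hS, hN0]
      rw [this, hint]
      rcases hc with rfl | rfl <;> simp [expKlBin, klBinReal]
    rw [lintegral_congr_ae this]
    rw [lintegral_const, measure_univ, mul_one]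
    exact ENNReal.one_le_ofReal.2 hone
  have hp0 : 0 ≤ ∫ z, f z ∂μ := integral_nonneg fun z => (hf01 z).1
  have hsub : ∫ z, (1 - f z) ∂μ = 1 - ∫ z, f z ∂μ := by
    rw [integral_sub (integrable_const 1) hfi]; simp
  have hp1 : 0 ≤ 1 - ∫ z, f z ∂μ := by
    rw [← hsub]
    exact integral_nonneg fun z => sub_nonneg.2 (hf01 z).2
  rcases hp0.eq_or_lt' with h0 | h0
  · refine hconst 0 (Or.inl rfl) ?_ h0
    exact (integral_eq_zero_iff_of_nonneg (fun z => (hf01 z).1) hfi).1 h0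
  rcases hp1.eq_or_lt' with h1 | h1
  · refine hconst 1 (Or.inr rfl) ?_ (by linarith)
    rw [← hsub] at h1
    filter_upwards [(integral_eq_zero_iff_of_nonneg (fun z => sub_nonneg.2 (hf01 z).2)
      ((integrable_const 1).sub hfi)).1 h1] with z hz
    simp only [Pi.zero_apply] at hz
    linarith
  · have h1' : ∫ z, f z ∂μ ≠ 1 := by linarith
    simp only [expKlBin, h0.ne', h1', false_and, or_self, if_false]
    exact lintegral_exp_klBinReal_le μ f hf hf01 N hN ⟨h0, by linarith⟩

theorem mul_log_add_sub_le {q p t : ℝ} (hq : 0 ≤ q) (hp : 0 ≤ p) (ht : 0 < t)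
    (h : p = 0 → q = 0) : q * Real.log t + q - t * p ≤ q * Real.log (q / p) := by
  rcases hq.eq_or_lt' with rfl | hq
  · have := mul_nonneg ht.le hp
    simp only [zero_mul]
    linarith
  have hp' : 0 < p := hp.lt_of_ne' fun h0 => hq.ne' (h h0)
  have h1 := Real.log_le_sub_one_of_pos (show 0 < t * p / q by positivity)
  rw [Real.log_div (by positivity) hq.ne', Real.log_mul ht.ne' hp'.ne'] at h1
  rw [Real.log_div hq.ne' hp'.ne']
  have h2 := mul_le_mul_of_nonneg_left h1 hq.le
  have h3 : q * (t * p / q - 1) = t * p - q := by field_simp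
  rw [h3] at h2
  linarith

/-- An affine minorant of the binary Kullback--Leibler divergence. -/
noncomputable def klBinTangent (t s q p : ℝ) : ℝ :=
  (q * Real.log t + q - t * p) + ((1 - q) * Real.log s + (1 - q) - s * (1 - p))

theorem ofReal_exp_klBinTangent_le (N : ℕ) {q p t s : ℝ} (hq : q ∈ Set.Icc (0 : ℝ) 1)
    (hp : p ∈ Set.Icc (0 : ℝ) 1) (ht : 0 < t) (hs : 0 < s) :
    ENNReal.ofReal (Real.exp (N * klBinTangent t s q p)) ≤ expKlBin N q p := by
  unfold expKlBin
  split_ifs with h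
  · exact le_top
  push Not at h
  refine ENNReal.ofReal_le_ofReal (Real.exp_le_exp.2 (mul_le_mul_of_nonneg_left ?_ (by positivity)))
  refine add_le_add (mul_log_add_sub_le hq.1 hp.1 ht h.1)
    (mul_log_add_sub_le (by linarith [hq.2]) (by linarith [hp.2]) hs fun h1 => ?_)
  have := h.2 (by linarith)
  linarith

theorem exists_mul_log_div_le {a b ε : ℝ} (ha : 0 ≤ a) (hb : 0 < b) (hε : 0 < ε) :
    ∃ t, 0 < t ∧ a * Real.log (a / b) ≤ a * Real.log t + a - t * b + ε := by
  rcases ha.eq_or_lt' with rfl | ha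
  · exact ⟨ε / b, by positivity, by simp [div_mul_cancel₀ _ hb.ne']⟩
  · exact ⟨a / b, by positivity, by rw [div_mul_cancel₀ _ hb.ne']; linarith⟩

/-- The binary divergence is the supremum of its affine minorants. -/
theorem klBinReal_le_of_forall_klBinTangent_le {a b C : ℝ} (ha : a ∈ Set.Icc (0 : ℝ) 1)
    (hb : b ∈ Set.Ioo (0 : ℝ) 1)
    (h : ∀ t s, 0 < t → 0 < s → klBinTangent t s a b ≤ C) : klBinReal a b ≤ C := by
  refine le_of_forall_pos_le_add fun ε hε => ?_
  obtain ⟨t, ht, h1⟩ := exists_mul_log_div_le ha.1 hb.1 (half_pos hε)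
  obtain ⟨s, hs, h2⟩ := exists_mul_log_div_le (sub_nonneg.2 ha.2) (sub_pos.2 hb.2) (half_pos hε)
  have := h t s ht hs
  unfold klBinTangent at this
  unfold klBinReal
  linarith

/-- The Donsker--Varadhan change of measure inequality. -/
theorem integral_le_integral_llr_add_log {H : Type*} [MeasurableSpace H] (P Q : Measure H)
    [IsProbabilityMeasure P] [IsProbabilityMeasure Q] (hQP : Q ≪ P)
    (hllr : Integrable (llr Q P) Q) (g : H → ℝ) (hgQ : Integrable g Q) (hg : Measurable g)
    (K : ℝ) (hK : 0 ≤ K) (hgK : ∫⁻ h, ENNReal.ofReal (Real.exp (g h)) ∂P ≤ ENNReal.ofReal K) :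
    ∫ h, g h ∂Q ≤ ∫ h, llr Q P h ∂Q + Real.log K := by
  have hexp : Integrable (fun h => Real.exp (g h)) P := by
    refine ⟨(Real.measurable_exp.comp hg).aestronglyMeasurable, ?_⟩
    rw [hasFiniteIntegral_iff_ofReal (ae_of_all _ fun h => (Real.exp_pos _).le)]
    exact hgK.trans_lt ENNReal.ofReal_lt_top
  have := isProbabilityMeasure_tilted hexp
  have hnn := InformationTheory.integral_llr_add_sub_measure_univ_nonneg
    (hQP.trans (absolutelyContinuous_tilted hexp))
    (integrable_llr_tilted_right hQP hgQ hllr hexp)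
  rw [integral_llr_tilted_right hQP hgQ hexp hllr] at hnn
  simp only [probReal_univ] at hnn
  have hle : ∫ h, Real.exp (g h) ∂P ≤ K := by
    rw [integral_eq_lintegral_of_nonneg_ae (ae_of_all _ fun h => (Real.exp_pos _).le)
      hexp.aestronglyMeasurable]
    exact ENNReal.toReal_le_of_le_ofReal hK hgK
  have hlog := Real.log_le_log (integral_exp_pos hexp) hle
  linarith

theorem le_klInv {a b : ℝ} {ε : ℝ≥0∞} (hb : b ∈ Set.Icc (0 : ℝ) 1) (h : klBin a b ≤ ε) :
    b ≤ klInv a ε :=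
  le_csSup ⟨1, fun _ hx => hx.1.2⟩ ⟨hb, h⟩

/-- The deterministic part of the PAC-Bayes bound. -/
theorem integral_le_klInv_of_lintegral_expKlBin_le {H : Type*} [MeasurableSpace H]
    (P Q : Measure H) [IsProbabilityMeasure P] [IsProbabilityMeasure Q] (q p : H → ℝ)
    (hq : Measurable q) (hp : Measurable p) (hq01 : ∀ h, q h ∈ Set.Icc (0 : ℝ) 1)
    (hp01 : ∀ h, p h ∈ Set.Icc (0 : ℝ) 1) (N : ℕ) (hN : 0 < N) (K : ℝ) (hK : 0 ≤ K)
    (hbound : ∫⁻ h, expKlBin N (q h) (p h) ∂P ≤ ENNReal.ofReal K) :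
    ∫ h, p h ∂Q ≤ klInv (∫ h, q h ∂Q)
      ((klDiv Q P + ENNReal.ofReal (Real.log K)) / (N : ℝ≥0∞)) := by
  have hqi : Integrable q Q := .of_mem_Icc 0 1 hq.aemeasurable (ae_of_all _ hq01)
  have hpi : Integrable p Q := .of_mem_Icc 0 1 hp.aemeasurable (ae_of_all _ hp01)
  have hmem : ∀ f : H → ℝ, Integrable f Q → (∀ h, f h ∈ Set.Icc (0 : ℝ) 1) →
      ∫ h, f h ∂Q ∈ Set.Icc (0 : ℝ) 1 := fun f hf hf01 =>
    ⟨integral_nonneg fun h => (hf01 h).1, by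
      simpa using integral_mono hf (integrable_const 1) fun h => (hf01 h).2⟩
  have ha := hmem q hqi hq01
  have hb := hmem p hpi hp01
  have hN0 : (0 : ℝ) < N := by positivity
  by_cases hac : Q ≪ P ∧ Integrable (fun h => Real.log ((Q.rnDeriv P h).toReal)) Q
  swap
  · refine le_klInv hb ?_
    rw [klDiv, if_neg hac, top_add, ENNReal.top_div_of_ne_top (ENNReal.natCast_ne_top N)]
    exact le_top
  obtain ⟨hQP, hllr⟩ := hac
  rcases hb.1.eq_or_lt' with hb0 | hb0
  · rw [hb0]
    exact Real.sSup_nonneg fun x hx => hx.1.1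
  rcases hb.2.eq_or_lt with hb1 | hb1
  · have hp1 : ∀ᵐ h ∂Q, p h = 1 := by
      have hz : ∫ h, (1 - p h) ∂Q = 0 := by
        rw [integral_sub (integrable_const 1) hpi]; simp [hb1]
      filter_upwards [(integral_eq_zero_iff_of_nonneg (fun h => sub_nonneg.2 (hp01 h).2)
        ((integrable_const 1).sub hpi)).1 hz] with h hh
      simp only [Pi.zero_apply] at hh
      linarith
    have hfin : ∀ᵐ h ∂Q, expKlBin N (q h) (p h) < ⊤ := hQP.ae_le
      (ae_lt_top (measurable_expKlBin N hq hp) (hbound.trans_lt ENNReal.ofReal_lt_top).ne)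
    have hq1 : ∀ᵐ h ∂Q, q h = 1 := by
      filter_upwards [hp1, hfin] with h h1 h2
      by_contra hne
      simp [expKlBin, h1, hne] at h2
    have ha1 : ∫ h, q h ∂Q = 1 := by
      rw [integral_congr_ae hq1]; simp
    refine le_klInv hb ?_
    simp [klBin, hb1, ha1]
  refine le_klInv hb ?_
  rw [klBin, if_neg (by push Not; exact ⟨hb0, hb1⟩), klDiv, if_pos ⟨hQP, hllr⟩]
  have hmain : klBinReal (∫ h, q h ∂Q) (∫ h, p h ∂Q)
      ≤ (∫ h, llr Q P h ∂Q + Real.log K) / N := by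
    refine klBinReal_le_of_forall_klBinTangent_le ha ⟨hb0, hb1⟩ fun t s ht hs => ?_
    rw [le_div_iff₀' hN0]
    have hgi : Integrable (fun h => (N : ℝ) * klBinTangent t s (q h) (p h)) Q := by
      unfold klBinTangent
      fun_prop
    have hgm : Measurable (fun h => (N : ℝ) * klBinTangent t s (q h) (p h)) := by
      unfold klBinTangent
      fun_prop
    have heq : ∫ h, (N : ℝ) * klBinTangent t s (q h) (p h) ∂Q
        = N * klBinTangent t s (∫ h, q h ∂Q) (∫ h, p h ∂Q) := by
      have haff : ∀ x y, klBinTangent t s x y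
          = x * (Real.log t - Real.log s) + y * (s - t) + (Real.log s + 1 - s) := by
        intro x y
        unfold klBinTangent
        ring
      simp_rw [haff]
      rw [integral_const_mul, integral_add (by fun_prop) (by fun_prop),
        integral_add (by fun_prop) (by fun_prop), integral_mul_const, integral_mul_const]
      simp
    rw [← heq]
    refine integral_le_integral_llr_add_log P Q hQP hllr _ hgi hgm K hK (le_trans ?_ hbound)
    exact lintegral_mono fun h => ofReal_exp_klBinTangent_le N (hq01 h) (hp01 h) ht hs
  refine (ENNReal.ofReal_le_ofReal hmain).trans ?_
  rw [ENNReal.ofReal_div_of_pos hN0, ENNReal.ofReal_natCast]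
  gcongr
  exact ENNReal.ofReal_add_le

/-- PAC-Bayes theorem of Langford--Seeger: for a `[0,1]`-valued loss,
any data distribution `𝒟`, prior `P`, sample size `N > 0` and `δ ∈ (0,1)`, with
probability at least `1 - δ` over `S ~ 𝒟^N`, simultaneously for all posteriors `Q`:
`R_𝒟(Q) ≤ klinv( R̂_S(Q), (KL(Q‖P) + log(2√N/δ)) / N )`. -/
theorem pac_bayes_langford_seeger
    {Z H : Type*} [MeasurableSpace Z] [MeasurableSpace H]
    (𝒟 : Measure Z) [IsProbabilityMeasure 𝒟]
    (ℓ : H → Z → ℝ) (hmeas : Measurable (Function.uncurry ℓ))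
    (hbound : ∀ h z, ℓ h z ∈ Set.Icc (0:ℝ) 1)
    (P : Measure H) [IsProbabilityMeasure P]
    (N : ℕ) (hN : 0 < N) (δ : ℝ) (hδ : δ ∈ Set.Ioo (0:ℝ) 1) :
    ENNReal.ofReal (1 - δ) ≤
      (Measure.pi fun _ : Fin N => 𝒟)
        {S : Fin N → Z | ∀ Q : Measure H, IsProbabilityMeasure Q →
          (∫ h, (∫ z, ℓ h z ∂𝒟) ∂Q)
            ≤ klInv ((1 / (N : ℝ)) * ∑ j, ∫ h, ℓ h (S j) ∂Q)
                ((klDiv Q P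
                    + ENNReal.ofReal (Real.log (2 * Real.sqrt (N : ℝ) / δ)))
                  / (N : ℝ≥0∞))} := by
  have hsec : ∀ h, Measurable (ℓ h) := fun h => hmeas.comp measurable_prodMk_left
  have hsec' : ∀ z, Measurable fun h => ℓ h z := fun z => hmeas.comp measurable_prodMk_right
  have hN0 : (0 : ℝ) < N := by positivity
  have hδ0 := hδ.1
  set π := Measure.pi fun _ : Fin N => 𝒟 with hπ
  set p : H → ℝ := fun h => ∫ z, ℓ h z ∂𝒟 with hpdef
  set q : H → (Fin N → Z) → ℝ := fun h S => (1 / (N : ℝ)) * ∑ j, ℓ h (S j) with hqdef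
  have hp : Measurable p := hmeas.stronglyMeasurable.integral_prod_right.measurable
  have hq : Measurable (Function.uncurry q) := by
    refine measurable_const.mul (Finset.measurable_sum _ fun j _ => ?_)
    exact hmeas.comp (measurable_fst.prodMk ((measurable_pi_apply j).comp measurable_snd))
  have hp01 : ∀ h, p h ∈ Set.Icc (0 : ℝ) 1 := fun h =>
    ⟨integral_nonneg fun z => (hbound h z).1, by
      have hi : Integrable (ℓ h) 𝒟 :=
        .of_mem_Icc 0 1 (hsec h).aemeasurable (ae_of_all _ (hbound h))
      simpa using integral_mono hi (integrable_const 1) fun z => (hbound h z).2⟩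
  have hq01 : ∀ h S, q h S ∈ Set.Icc (0 : ℝ) 1 := fun h S =>
    ⟨mul_nonneg (by positivity) (sum_nonneg fun j _ => (hbound h (S j)).1), by
      have : ∑ j, ℓ h (S j) ≤ ∑ _j : Fin N, (1 : ℝ) := sum_le_sum fun j _ => (hbound h (S j)).2
      simp only [sum_const, card_univ, Fintype.card_fin, nsmul_eq_mul, mul_one] at this
      rw [hqdef, one_div, inv_mul_le_iff₀ hN0]
      linarith⟩
  have hE : Measurable (Function.uncurry fun h S => expKlBin N (q h S) (p h)) :=
    measurable_expKlBin N hq (hp.comp measurable_fst)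
  set M : (Fin N → Z) → ℝ≥0∞ := fun S => ∫⁻ h, expKlBin N (q h S) (p h) ∂P with hM
  have hMm : Measurable M := hE.lintegral_prod_left'
  have hMint : ∫⁻ S, M S ∂π ≤ ENNReal.ofReal (2 * √N) := by
    rw [hM, ← lintegral_lintegral_swap hE.aemeasurable]
    calc _ ≤ ∫⁻ _ : H, ENNReal.ofReal (2 * √N) ∂P :=
          lintegral_mono fun h => lintegral_expKlBin_le 𝒟 (ℓ h) (hsec h) (hbound h) N hN
      _ = _ := by simp
  set K : ℝ := 2 * √N / δ with hK
  have hKpos : 0 < K := by positivity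
  have hbad : π {S | ENNReal.ofReal K ≤ M S} ≤ ENNReal.ofReal δ := by
    have h := (mul_meas_ge_le_lintegral (μ := π) hMm (ENNReal.ofReal K)).trans hMint
    have hc : 2 * √N = K * δ := by rw [hK, div_mul_cancel₀ _ hδ0.ne']
    rw [hc, ENNReal.ofReal_mul hKpos.le] at h
    exact (ENNReal.mul_le_mul_iff_right (by simpa using hKpos) ENNReal.ofReal_ne_top).1 h
  have hgood : ENNReal.ofReal (1 - δ) ≤ π {S | ENNReal.ofReal K ≤ M S}ᶜ := by
    rw [prob_compl_eq_one_sub (measurableSet_le measurable_const hMm),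
      ENNReal.ofReal_sub _ hδ0.le, ENNReal.ofReal_one]
    exact tsub_le_tsub_left hbad 1
  refine hgood.trans (measure_mono fun S hS Q hQ => ?_)
  have hMS : M S ≤ ENNReal.ofReal K := le_of_not_ge fun h => hS h
  have key := integral_le_klInv_of_lintegral_expKlBin_le P Q (fun h => q h S) p
    (hq.comp measurable_prodMk_right) hp (fun h => hq01 h S) hp01 N hN K hKpos.le hMS
  have hemp : ∫ h, q h S ∂Q = (1 / (N : ℝ)) * ∑ j, ∫ h, ℓ h (S j) ∂Q := by
    rw [hqdef, integral_const_mul, integral_finsetSum]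
    exact fun j _ => .of_mem_Icc 0 1 (hsec' _).aemeasurable (ae_of_all _ fun h => hbound h _)
  rwa [hemp] at key
end

section
/- (Gumbel–Max trick.) Let n ∈ ℕ, let λ⁰_1, …, λ⁰_n > 0 be unnormalized probabilities, and let U_1, …, U_n be i.i.d. Uniform(0,1) random variables. Then almost surely the index K = argmax_{k ∈ {1,…,n}} ( log(λ⁰_k) − log(−log U_k) ) is uniquely attained, and for every k, P(K = k) = λ⁰_k / Σ_{i=1}^n λ⁰_i. -/
open MeasureTheory Finset

/-- For `x, y ∈ (0,1)`, comparing perturbed log-weights amounts to comparing `y` with a power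
of `x`. -/
lemma log_sub_log_neg_log_lt_iff {a b x y : ℝ} (ha : 0 < a) (hb : 0 < b)
    (hx : x ∈ Set.Ioo (0 : ℝ) 1) (hy : y ∈ Set.Ioo (0 : ℝ) 1) :
    Real.log a - Real.log (-Real.log y) < Real.log b - Real.log (-Real.log x)
      ↔ y < x ^ (a / b) := by
  have hlx : 0 < -Real.log x := neg_pos.2 (Real.log_neg hx.1 hx.2)
  have hly : 0 < -Real.log y := neg_pos.2 (Real.log_neg hy.1 hy.2)
  rw [← Real.log_div ha.ne' hly.ne', ← Real.log_div hb.ne' hlx.ne',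
    Real.log_lt_log_iff (div_pos ha hly) (div_pos hb hlx), div_lt_div_iff₀ hly hlx,
    ← Real.log_lt_log_iff hy.1 (Real.rpow_pos_of_pos hx.1 _), Real.log_rpow hx.1,
    div_mul_eq_mul_div, lt_div_iff₀ hb]
  constructor <;> intro h <;> linarith

/-- The conditional probability that one competitor loses, given the uniform variable `x` of the
candidate maximizer. -/
lemma volume_restrict_Ioo_log_sub_log_neg_log_lt {a b x : ℝ} (ha : 0 < a) (hb : 0 < b)
    (hx : x ∈ Set.Ioo (0 : ℝ) 1) :
    volume.restrict (Set.Ioo (0 : ℝ) 1)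
        {y | Real.log a - Real.log (-Real.log y) < Real.log b - Real.log (-Real.log x)}
      = ENNReal.ofReal (x ^ (a / b)) := by
  have hle : x ^ (a / b) ≤ 1 := Real.rpow_le_one hx.1.le hx.2.le (div_pos ha hb).le
  rw [Measure.restrict_apply' measurableSet_Ioo]
  have : {y | Real.log a - Real.log (-Real.log y) < Real.log b - Real.log (-Real.log x)}
      ∩ Set.Ioo (0 : ℝ) 1 = Set.Ioo 0 (x ^ (a / b)) := by
    ext y
    constructor
    · rintro ⟨h, hy⟩
      exact ⟨hy.1, (log_sub_log_neg_log_lt_iff ha hb hx hy).1 h⟩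
    · rintro ⟨h0, h1⟩
      have hy : y ∈ Set.Ioo (0 : ℝ) 1 := ⟨h0, h1.trans_le hle⟩
      exact ⟨(log_sub_log_neg_log_lt_iff ha hb hx hy).2 h1, hy⟩
  rw [this, Real.volume_Ioo, sub_zero]

lemma lintegral_Ioo_rpow {s : ℝ} (hs : 0 ≤ s) :
    ∫⁻ x in Set.Ioo (0 : ℝ) 1, ENNReal.ofReal (x ^ s) = ENNReal.ofReal (1 / (s + 1)) := by
  have hint : IntervalIntegrable (fun x : ℝ => x ^ s) volume 0 1 :=
    intervalIntegral.intervalIntegrable_rpow' (by linarith)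
  rw [restrict_Ioo_eq_restrict_Ioc, ← ofReal_integral_eq_lintegral_ofReal,
    ← intervalIntegral.integral_of_le zero_le_one, integral_rpow (Or.inl (by linarith))]
  · rw [Real.one_rpow, Real.zero_rpow (by linarith), sub_zero]
  · exact (intervalIntegrable_iff_integrableOn_Ioc_of_le zero_le_one).1 hint
  · filter_upwards [ae_restrict_mem measurableSet_Ioc] with x hx
    exact Real.rpow_nonneg hx.1.le s

lemma measurableSet_forall_log_sub_log_neg_log_lt {n : ℕ} (lam : Fin n → ℝ) (k : Fin n) :
    MeasurableSet {u : Fin n → ℝ | ∀ i, i ≠ k →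
      Real.log (lam i) - Real.log (-Real.log (u i))
        < Real.log (lam k) - Real.log (-Real.log (u k))} := by
  simp only [Set.ofPred_forall]
  refine MeasurableSet.iInter fun i => MeasurableSet.iInter fun _ => ?_
  exact measurableSet_lt (by fun_prop) (by fun_prop)

/-- The probability that `k` is the strict maximizer. -/
lemma pi_forall_log_sub_log_neg_log_lt {n : ℕ} (lam : Fin n → ℝ) (hlam : ∀ k, 0 < lam k)
    (k : Fin n) :
    (Measure.pi fun _ : Fin n => volume.restrict (Set.Ioo (0 : ℝ) 1))
        {u : Fin n → ℝ | ∀ i, i ≠ k →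
          Real.log (lam i) - Real.log (-Real.log (u i))
            < Real.log (lam k) - Real.log (-Real.log (u k))}
      = ENNReal.ofReal (lam k / ∑ i, lam i) := by
  obtain _ | m := n
  · exact k.elim0
  have hS := measurableSet_forall_log_sub_log_neg_log_lt lam k
  have hmp := (measurePreserving_piFinSuccAbove
    (fun _ : Fin (m + 1) => volume.restrict (Set.Ioo (0 : ℝ) 1)) k).symm
  rw [← hmp.measure_preimage hS.nullMeasurableSet,
    Measure.prod_apply (hmp.measurable hS)]
  have hsection : ∀ x ∈ Set.Ioo (0 : ℝ) 1,
      (Measure.pi fun _ : Fin m => volume.restrict (Set.Ioo (0 : ℝ) 1))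
        (Prod.mk x ⁻¹' ((MeasurableEquiv.piFinSuccAbove (fun _ => ℝ) k).symm ⁻¹'
          {u : Fin (m + 1) → ℝ | ∀ i, i ≠ k →
            Real.log (lam i) - Real.log (-Real.log (u i))
              < Real.log (lam k) - Real.log (-Real.log (u k))}))
        = ENNReal.ofReal (x ^ (∑ j, lam (k.succAbove j) / lam k)) := by
    intro x hx
    have hset : Prod.mk x ⁻¹' ((MeasurableEquiv.piFinSuccAbove (fun _ => ℝ) k).symm ⁻¹'
          {u : Fin (m + 1) → ℝ | ∀ i, i ≠ k →
            Real.log (lam i) - Real.log (-Real.log (u i))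
              < Real.log (lam k) - Real.log (-Real.log (u k))})
        = Set.univ.pi fun j : Fin m => {y : ℝ | Real.log (lam (k.succAbove j))
            - Real.log (-Real.log y) < Real.log (lam k) - Real.log (-Real.log x)} := by
      ext v
      simp [Fin.forall_iff_succAbove k, Fin.insertNthEquiv, Fin.succAbove_ne]
    rw [hset, Measure.pi_pi, Real.rpow_sum_of_pos hx.1,
      ENNReal.ofReal_prod_of_nonneg fun j _ => Real.rpow_nonneg hx.1.le _]
    exact Finset.prod_congr rfl fun j _ =>
      volume_restrict_Ioo_log_sub_log_neg_log_lt (hlam _) (hlam k) hx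
  rw [setLIntegral_congr_fun measurableSet_Ioo hsection,
    lintegral_Ioo_rpow (Finset.sum_nonneg fun j _ => (div_pos (hlam _) (hlam k)).le),
    ← Finset.sum_div, div_add_one (hlam k).ne', one_div_div, Fin.sum_univ_succAbove lam k,
    add_comm]

/-- Gumbel--Max trick: with `U_1, …, U_n` i.i.d. `Uniform(0,1)` and
unnormalized probabilities `λ_k > 0`, almost surely the argmax of
`log λ_k - log(-log U_k)` is uniquely attained (i.e. with probability one there is
a strict maximizer), and for every `k` the probability that `k` is the strict
maximizer equals `λ_k / Σ_i λ_i`. -/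
theorem gumbel_max_trick
    (n : ℕ) (hn : 0 < n) (lam : Fin n → ℝ) (hlam : ∀ k, 0 < lam k) :
    (Measure.pi fun _ : Fin n => volume.restrict (Set.Ioo (0:ℝ) 1))
        {u : Fin n → ℝ | ∃ k : Fin n, ∀ i, i ≠ k →
          Real.log (lam i) - Real.log (-Real.log (u i))
            < Real.log (lam k) - Real.log (-Real.log (u k))} = 1
    ∧ ∀ k : Fin n,
        (Measure.pi fun _ : Fin n => volume.restrict (Set.Ioo (0:ℝ) 1))
            {u : Fin n → ℝ | ∀ i, i ≠ k →
              Real.log (lam i) - Real.log (-Real.log (u i))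
                < Real.log (lam k) - Real.log (-Real.log (u k))}
          = ENNReal.ofReal (lam k / ∑ i, lam i) := by
  refine ⟨?_, pi_forall_log_sub_log_neg_log_lt lam hlam⟩
  have : Nonempty (Fin n) := ⟨⟨0, hn⟩⟩
  have hsum : 0 < ∑ i, lam i := Finset.sum_pos (fun i _ => hlam i) Finset.univ_nonempty
  rw [Set.ofPred_exists, measure_iUnion]
  · simp_rw [pi_forall_log_sub_log_neg_log_lt lam hlam]
    rw [tsum_fintype, ← ENNReal.ofReal_sum_of_nonneg fun k _ => (div_pos (hlam k) hsum).le,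
      ← Finset.sum_div, div_self hsum.ne', ENNReal.ofReal_one]
  · intro k l hkl
    refine Set.disjoint_left.2 fun u hk hl => ?_
    exact lt_asymm (hk l hkl.symm) (hl k hkl)
  · exact measurableSet_forall_log_sub_log_neg_log_lt lam
end

section
/- (Gumbel–Softmax / Concrete distribution recovers the categorical probabilities.) Let n ∈ ℕ, λ⁰_1, …, λ⁰_n > 0, let G_1, …, G_n be i.i.d. standard Gumbel random variables, and for β > 0 define X_k = exp((log(λ⁰_k) + G_k)/β) / Σ_{i=1}^n exp((log(λ⁰_i) + G_i)/β). Then for every β > 0 and every k, P( X_k > X_i for all i ≠ k ) = λ⁰_k / Σ_{i=1}^n λ⁰_i; in particular, lim_{β → 0} P( X_k > X_i for all i ≠ k ) = λ⁰_k / Σ_{i=1}^n λ⁰_i. -/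
open MeasureTheory Finset

/-- If `f` has a continuous nonnegative derivative `f'` and tends to `m` at `-∞`, then the Lebesgue
integral of `f'` over `(-∞, b]` is `f b - m`. -/
lemma lintegral_Iic_of_hasDerivAt_of_nonneg {f f' : ℝ → ℝ} {m : ℝ}
    (hderiv : ∀ x, HasDerivAt f (f' x) x) (hcont : Continuous f') (hnonneg : ∀ x, 0 ≤ f' x)
    (hf : Filter.Tendsto f Filter.atBot (nhds m)) (b : ℝ) :
    ∫⁻ x in Set.Iic b, ENNReal.ofReal (f' x) = ENNReal.ofReal (f b - m) := by
  have hint : IntegrableOn f' (Set.Iic b) := by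
    refine integrableOn_Iic_of_intervalIntegral_norm_tendsto (f b - m) b
      (fun i : ℝ => hcont.integrableOn_Ioc) Filter.tendsto_id ?_
    have hnorm : (fun i : ℝ => ∫ x in id i..b, ‖f' x‖) = fun i => f b - f i := by
      funext i
      simp only [Real.norm_of_nonneg (hnonneg _), id]
      exact intervalIntegral.integral_eq_sub_of_hasDerivAt (fun x _ => hderiv x)
        (hcont.intervalIntegrable _ _)
    rw [hnorm]
    exact hf.const_sub _
  rw [← ofReal_integral_eq_lintegral_ofReal hint (Filter.Eventually.of_forall hnonneg),
    integral_Iic_of_hasDerivAt_of_tendsto' (fun x _ => hderiv x) hint hf]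

/-- The function `x ↦ exp (-x) * exp (-a * exp (-x))` integrates to `exp (-a * exp (-b)) / a` over
`(-∞, b]`. -/
lemma lintegral_Iic_exp_neg_mul_exp_neg_mul_exp_neg {a : ℝ} (ha : 0 < a) (b : ℝ) :
    ∫⁻ x in Set.Iic b, ENNReal.ofReal (Real.exp (-x) * Real.exp (-a * Real.exp (-x)))
      = ENNReal.ofReal (Real.exp (-a * Real.exp (-b)) / a) := by
  have hderiv : ∀ x : ℝ, HasDerivAt (fun x => Real.exp (-a * Real.exp (-x)) / a)
      (Real.exp (-x) * Real.exp (-a * Real.exp (-x))) x := by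
    intro x
    refine ((((hasDerivAt_neg x).exp).const_mul (-a)).exp.div_const a).congr_deriv (Eq.symm ?_)
    rw [eq_div_iff ha.ne']
    ring
  have hlim : Filter.Tendsto (fun x : ℝ => Real.exp (-a * Real.exp (-x)) / a)
      Filter.atBot (nhds 0) := by
    have h := Real.tendsto_exp_atBot.comp ((Real.tendsto_exp_atTop.comp
      Filter.tendsto_neg_atBot_atTop).const_mul_atTop_of_neg (neg_neg_of_pos ha))
    simpa using h.div_const a
  simpa using lintegral_Iic_of_hasDerivAt_of_nonneg hderiv (by fun_prop)
    (fun x => by positivity) hlim b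

/-- The function `x ↦ exp (-x) * exp (-a * exp (-x))` integrates to `1 / a` over the real line. -/
lemma lintegral_exp_neg_mul_exp_neg_mul_exp_neg {a : ℝ} (ha : 0 < a) :
    ∫⁻ x, ENNReal.ofReal (Real.exp (-x) * Real.exp (-a * Real.exp (-x)))
      = ENNReal.ofReal (1 / a) := by
  refine (aecover_Iic Filter.tendsto_id).lintegral_eq_of_tendsto _ (by fun_prop) ?_
  simp only [id, lintegral_Iic_exp_neg_mul_exp_neg_mul_exp_neg ha]
  refine ENNReal.tendsto_ofReal (Filter.Tendsto.div_const ?_ a)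
  have h := (Real.continuous_exp.tendsto _).comp
    ((Real.tendsto_exp_neg_atTop_nhds_zero).const_mul (-a))
  simpa [Function.comp_def] using h

/-- A measure with the standard Gumbel distribution function has density `exp (-x - exp (-x))`. -/
lemma eq_withDensity_of_gumbel_cdf {μ : Measure ℝ} [IsFiniteMeasure μ]
    (hμ : ∀ x : ℝ, μ (Set.Iic x) = ENNReal.ofReal (Real.exp (-Real.exp (-x)))) :
    μ = volume.withDensity
      fun x => ENNReal.ofReal (Real.exp (-x) * Real.exp (-Real.exp (-x))) := by
  refine Measure.ext_of_Iic _ _ fun b => ?_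
  rw [hμ, withDensity_apply _ measurableSet_Iic]
  simpa using (lintegral_Iic_exp_neg_mul_exp_neg_mul_exp_neg one_pos b).symm

/-- The Laplace transform of `exp (-G)` for a standard Gumbel variable `G`. -/
lemma lintegral_exp_neg_mul_exp_neg_of_gumbel_cdf {μ : Measure ℝ} [IsFiniteMeasure μ]
    (hμ : ∀ x : ℝ, μ (Set.Iic x) = ENNReal.ofReal (Real.exp (-Real.exp (-x))))
    {c : ℝ} (hc : 0 ≤ c) :
    ∫⁻ x, ENNReal.ofReal (Real.exp (-c * Real.exp (-x))) ∂μ = ENNReal.ofReal (1 / (1 + c)) := by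
  rw [eq_withDensity_of_gumbel_cdf hμ,
    lintegral_withDensity_eq_lintegral_mul _ (by fun_prop) (by fun_prop),
    ← lintegral_exp_neg_mul_exp_neg_mul_exp_neg (by positivity : 0 < 1 + c)]
  refine lintegral_congr fun x => ?_
  rw [Pi.mul_apply, ← ENNReal.ofReal_mul (by positivity), mul_assoc, ← Real.exp_add]
  ring_nf

/-- The Gumbel-max trick: the perturbed log-weight with index `k` is the strict maximum with
probability proportional to the weight of `k`. -/
lemma gumbel_max_probability {n : ℕ} {lam : Fin n → ℝ} (hlam : ∀ k, 0 < lam k)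
    {μ : Measure ℝ} [IsFiniteMeasure μ]
    (hμ : ∀ x : ℝ, μ (Set.Iic x) = ENNReal.ofReal (Real.exp (-Real.exp (-x)))) (k : Fin n) :
    (Measure.pi fun _ : Fin n => μ)
        {g : Fin n → ℝ | ∀ i, i ≠ k → Real.log (lam i) + g i < Real.log (lam k) + g k}
      = ENNReal.ofReal (lam k / ∑ i, lam i) := by
  obtain _ | n := n
  · exact k.elim0
  have : NullSingletonClass μ := by
    rw [eq_withDensity_of_gumbel_cdf hμ]
    infer_instance
  let s : Set (ℝ × (Fin n → ℝ)) :=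
    {p | ∀ j, Real.log (lam (k.succAbove j)) + p.2 j < Real.log (lam k) + p.1}
  have hs : MeasurableSet s := by
    refine measurableSet_setOfPred.2 (Measurable.forall fun j => ?_)
    exact measurableSet_setOfPred.1 (measurableSet_lt (by fun_prop) (by fun_prop))
  have hpre : {g : Fin (n + 1) → ℝ | ∀ i, i ≠ k →
      Real.log (lam i) + g i < Real.log (lam k) + g k}
      = MeasurableEquiv.piFinSuccAbove (fun _ => ℝ) k ⁻¹' s := by
    ext g
    simp only [Set.mem_ofPred_eq, k.forall_iff_succAbove, ne_eq, not_true_eq_false, false_imp_iff,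
      Fin.succAbove_ne, not_false_eq_true, true_imp_iff, true_and]
    rfl
  have hslice : ∀ x : ℝ, (Measure.pi fun _ : Fin n => μ) (Prod.mk x ⁻¹' s)
      = ENNReal.ofReal (Real.exp (-(∑ j, lam (k.succAbove j) / lam k) * Real.exp (-x))) := by
    intro x
    have hbox : Prod.mk x ⁻¹' s = Set.univ.pi fun j =>
        Set.Iio (Real.log (lam k) + x - Real.log (lam (k.succAbove j))) := by
      ext h
      simp [s, lt_sub_iff_add_lt']
    rw [hbox, Measure.pi_pi]
    simp only [measure_congr Iio_ae_eq_Iic, hμ]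
    rw [← ENNReal.ofReal_prod_of_nonneg fun _ _ => (Real.exp_pos _).le, ← Real.exp_sum,
      Finset.sum_neg_distrib, neg_mul, Finset.sum_mul]
    congr 3
    refine Finset.sum_congr rfl fun j _ => ?_
    rw [show -(Real.log (lam k) + x - Real.log (lam (k.succAbove j)))
        = Real.log (lam (k.succAbove j)) - Real.log (lam k) + -x by ring,
      Real.exp_add, Real.exp_sub, Real.exp_log (hlam _), Real.exp_log (hlam _)]
  rw [hpre, (measurePreserving_piFinSuccAbove (fun _ => μ) k).measure_preimage
    hs.nullMeasurableSet, Measure.prod_apply hs]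
  simp only [hslice]
  rw [lintegral_exp_neg_mul_exp_neg_of_gumbel_cdf hμ
      (Finset.sum_nonneg fun j _ => (div_pos (hlam _) (hlam _)).le),
    Fin.sum_univ_succAbove _ k, ← Finset.sum_div]
  have hk := hlam k
  congr 1
  field_simp

/-- Softmax coordinates at positive temperature are ordered like their logits. -/
lemma softmax_lt_softmax_iff {ι : Type*} [Fintype ι] (v : ι → ℝ) {β : ℝ} (hβ : 0 < β) (i k : ι) :
    Real.exp (v i / β) / ∑ m, Real.exp (v m / β) < Real.exp (v k / β) / ∑ m, Real.exp (v m / β)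
      ↔ v i < v k := by
  have hsum : 0 < ∑ m, Real.exp (v m / β) :=
    Finset.sum_pos (fun _ _ => Real.exp_pos _) ⟨k, Finset.mem_univ k⟩
  rw [div_lt_div_iff_of_pos_right hsum, Real.exp_lt_exp, div_lt_div_iff_of_pos_right hβ]

/-- Gumbel--Softmax / Concrete distribution recovers the categorical
probabilities: with `G_1, …, G_n` i.i.d. standard Gumbel (CDF `exp(-exp(-x))`),
unnormalized probabilities `λ_k > 0`, and for `β > 0` the Concrete coordinates
`X_k = exp((log λ_k + G_k)/β) / Σ_i exp((log λ_i + G_i)/β)`, one has for every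
`β > 0` that `P(X_k > X_i for all i ≠ k) = λ_k / Σ_i λ_i`; in particular this
probability tends to `λ_k / Σ_i λ_i` as `β → 0⁺`. -/
theorem gumbel_softmax_argmax_probability
    (n : ℕ) (hn : 0 < n) (lam : Fin n → ℝ) (hlam : ∀ k, 0 < lam k)
    (μ : Measure ℝ) [IsProbabilityMeasure μ]
    (hμ : ∀ x : ℝ, μ (Set.Iic x) = ENNReal.ofReal (Real.exp (-Real.exp (-x))))
    (k : Fin n) :
    (∀ β : ℝ, 0 < β →
      (Measure.pi fun _ : Fin n => μ)
          {g : Fin n → ℝ | ∀ i, i ≠ k →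
            Real.exp ((Real.log (lam i) + g i) / β)
                / (∑ m, Real.exp ((Real.log (lam m) + g m) / β))
              < Real.exp ((Real.log (lam k) + g k) / β)
                / (∑ m, Real.exp ((Real.log (lam m) + g m) / β))}
        = ENNReal.ofReal (lam k / ∑ i, lam i))
    ∧ Filter.Tendsto
        (fun β : ℝ =>
          (Measure.pi fun _ : Fin n => μ)
            {g : Fin n → ℝ | ∀ i, i ≠ k →
              Real.exp ((Real.log (lam i) + g i) / β)
                  / (∑ m, Real.exp ((Real.log (lam m) + g m) / β))
                < Real.exp ((Real.log (lam k) + g k) / β)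
                  / (∑ m, Real.exp ((Real.log (lam m) + g m) / β))})
        (nhdsWithin 0 (Set.Ioi (0:ℝ)))
        (nhds (ENNReal.ofReal (lam k / ∑ i, lam i))) := by
  refine (and_iff_left_of_imp fun h => ?_).2 fun β hβ => ?_
  · refine tendsto_const_nhds.congr' ?_
    filter_upwards [self_mem_nhdsWithin] with β hβ using (h β hβ).symm
  · simp only [softmax_lt_softmax_iff (fun m => Real.log (lam m) + _) hβ]
    exact gumbel_max_probability hlam hμ k
end
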